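/- arXiv:math/0512290 — 4 statements merged into one kernel-verified Lean document; each statement's English description precedes it below -/
import Mathlib

section
/- Let B be a ⋆-monoid, E a complex Hilbert space, e ∈ 𝓛(E) an orthogonal projection, and λ : B → 𝓛(E) any map. Define the dissipator Δ(x,z) = λ(x⋆z) − e∘λ(z) − λ(x⋆)∘e + e∘λ(1)∘e for x, z ∈ B. Then λ is conditionally positive definite with respect to e if and only if Δ is a positive definite kernel, i.e. Σ_{i,j} ⟪ζ_i, Δ(y_i, y_j) ζ_j⟫ ≥ 0 for every finite family y₁, …, y_N ∈ B and ζ₁, …, ζ_N ∈ E. -/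
open scoped ComplexOrder

local notation "⟪" x ", " y "⟫" => @inner ℂ _ _ x y

/-- A map `lam : B → 𝓛(E)` is conditionally positive definite with respect to an
orthogonal projection `e` if `∑ᵢⱼ ⟪ζᵢ, lam(yᵢ⋆ yⱼ) ζⱼ⟫ ≥ 0` whenever `∑ᵢ e ζᵢ = 0`. -/
def IsCPDwrt {B E : Type*} [Monoid B] [StarMul B]
    [NormedAddCommGroup E] [InnerProductSpace ℂ E]
    (e : E →L[ℂ] E) (lam : B → E →L[ℂ] E) : Prop :=
  ∀ (N : ℕ) (y : Fin N → B) (ζ : Fin N → E),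
    (∑ i, e (ζ i)) = 0 →
      0 ≤ ∑ i, ∑ j, ⟪ζ i, lam (star (y i) * y j) (ζ j)⟫

theorem sum_inner_dissipator
    {B E : Type*} [Monoid B] [StarMul B]
    [NormedAddCommGroup E] [InnerProductSpace ℂ E] [CompleteSpace E]
    (e : E →L[ℂ] E) (he_sa : IsSelfAdjoint e) (lam : B → E →L[ℂ] E)
    {ι : Type*} [Fintype ι] (y : ι → B) (ζ : ι → E) :
    ∑ i, ∑ j, ⟪ζ i, (lam (star (y i) * y j) - e ∘L lam (y j)
        - lam (star (y i)) ∘L e + e ∘L lam 1 ∘L e) (ζ j)⟫ =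
      ∑ i, ∑ j, ⟪ζ i, lam (star (y i) * y j) (ζ j)⟫
        - ∑ j, ⟪∑ i, e (ζ i), lam (y j) (ζ j)⟫
        - ∑ i, ⟪ζ i, lam (star (y i)) (∑ j, e (ζ j))⟫
        + ⟪∑ i, e (ζ i), lam 1 (∑ j, e (ζ j))⟫ := by
  have he : ∀ u v : E, ⟪u, e v⟫ = ⟪e u, v⟫ := fun u v => (he_sa.isSymmetric u v).symm
  simp only [add_apply, sub_apply, ContinuousLinearMap.comp_apply, inner_add_right,
    inner_sub_right, he, Finset.sum_add_distrib, Finset.sum_sub_distrib, map_sum, sum_inner,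
    inner_sum]
  congr 1
  · congr 2
    exact Finset.sum_comm
  · exact Finset.sum_comm

theorem cpd_iff_dissipator_pd
    {B E : Type*} [Monoid B] [StarMul B]
    [NormedAddCommGroup E] [InnerProductSpace ℂ E] [CompleteSpace E]
    (e : E →L[ℂ] E) (he_idem : IsIdempotentElem e) (he_sa : IsSelfAdjoint e)
    (lam : B → E →L[ℂ] E) :
    IsCPDwrt e lam ↔
      ∀ (N : ℕ) (y : Fin N → B) (ζ : Fin N → E),
        0 ≤ ∑ i, ∑ j,
          ⟪ζ i, (lam (star (y i) * y j) - e ∘L lam (y j)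
                  - lam (star (y i)) ∘L e + e ∘L lam 1 ∘L e) (ζ j)⟫ := by
  constructor
  · intro h N y ζ
    rw [sum_inner_dissipator e he_sa]
    have hid : ∀ v, e (e v) = e v := fun v => DFunLike.congr_fun he_idem v
    have key := h (N + 1) (Fin.cons 1 y) (Fin.cons (-∑ i, e (ζ i)) ζ)
      (by simp [Fin.sum_univ_succ, hid])
    convert key using 1
    simp only [Fin.sum_univ_succ, Fin.cons_zero, Fin.cons_succ, star_one, one_mul, mul_one,
      map_neg, inner_neg_left, inner_neg_right, Finset.sum_add_distrib, Finset.sum_neg_distrib]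
    ring
  · intro h N y ζ hζ
    have key := h N y ζ
    rw [sum_inner_dissipator e he_sa] at key
    simpa [hζ] using key
end

section
/- Let B be a ⋆-monoid, H a complex Hilbert space, E = ℂ ⊕ H the Hilbert space direct sum, and e ∈ 𝓛(E) the orthogonal projection (ζ,η) ↦ (ζ,0). Suppose given a complex inner product space K, a unital ⋆-representation j of B on K, a j-cocycle k : B → K, a function l : B → ℂ with the coboundary property relative to (j,k) and satisfying l(y⋆) = conj(l(y)), a linear map L : H →ₗ K, a linear functional L⁻ : H →ₗ ℂ, and a real constant d. If λ : B → 𝓛(E) satisfies λ(y⋆) = λ(y)† and, for all y ∈ B and η, η' ∈ H: ⟪(1,0), λ(y)(1,0)⟫ = l(y) + d, ⟪(1,0), λ(y)(0,η)⟫ = ⟪k(y⋆), Lη⟫ + L⁻η, and ⟪(0,η), λ(y)(0,η')⟫ = ⟪Lη, j(y)(Lη')⟫, then λ is conditionally positive definite with respect to e. -/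
open scoped ComplexOrder

local notation "⟪" x ", " y "⟫" => @inner ℂ _ _ x y

/-- The orthogonal projection `(ζ, η) ↦ (ζ, 0)` on the Hilbert direct sum `ℂ ⊕ H`. -/
noncomputable def eProj (H : Type*) [NormedAddCommGroup H] [InnerProductSpace ℂ H] :
    WithLp 2 (ℂ × H) →L[ℂ] WithLp 2 (ℂ × H) :=
  (WithLp.prodContinuousLinearEquiv 2 ℂ ℂ H).symm.toContinuousLinearMap ∘L
    ((ContinuousLinearMap.fst ℂ ℂ H).prod (0 : ℂ × H →L[ℂ] H)) ∘L
      (WithLp.prodContinuousLinearEquiv 2 ℂ ℂ H).toContinuousLinearMap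

/-- The element of `ℂ ⊕ H` with components `ζ` and `η`. -/
noncomputable def emb {H : Type*} [NormedAddCommGroup H] [InnerProductSpace ℂ H]
    (ζ : ℂ) (η : H) : WithLp 2 (ℂ × H) :=
  (WithLp.equiv 2 (ℂ × H)).symm (ζ, η)

theorem emb_eq_smul_add {H : Type*} [NormedAddCommGroup H] [InnerProductSpace ℂ H]
    (x : WithLp 2 (ℂ × H)) : x = x.fst • emb 1 (0 : H) + emb 0 x.snd := by
  apply (WithLp.equiv 2 (ℂ × H)).injective
  ext <;> simp [emb]

theorem eProj_fst {H : Type*} [NormedAddCommGroup H] [InnerProductSpace ℂ H]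
    (x : WithLp 2 (ℂ × H)) : (eProj H x).fst = x.fst := by
  simp [eProj]

/-- A kernel which differs from a Gram matrix by terms that vanish on families of weight zero
has a nonnegative sum. -/
theorem sum_sum_nonneg_of_eq_inner_add {ι K : Type*} [Fintype ι]
    [NormedAddCommGroup K] [InnerProductSpace ℂ K]
    (F : ι → ι → ℂ) (v : ι → K) (z a b : ι → ℂ) (hz : ∑ i, z i = 0)
    (hF : ∀ i j, F i j = ⟪v i, v j⟫ + starRingEnd ℂ (z i) * a j + b i * z j) :
    0 ≤ ∑ i, ∑ j, F i j := by
  have hz' : ∑ i, starRingEnd ℂ (z i) = 0 := by rw [← map_sum, hz, map_zero]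
  have key : ∑ i, ∑ j, F i j = ⟪∑ i, v i, ∑ j, v j⟫ := by
    simp only [hF, Finset.sum_add_distrib, ← Finset.mul_sum, ← Finset.sum_mul, hz, hz',
      sum_inner, inner_sum]
    rw [Finset.sum_comm]
    ring
  rw [key, inner_self_eq_norm_sq_to_K, ← RCLike.ofReal_pow]
  exact Complex.zero_le_real.mpr (sq_nonneg _)

theorem cpd_of_dilation
    {B : Type*} [Monoid B] [StarMul B]
    {H : Type*} [NormedAddCommGroup H] [InnerProductSpace ℂ H] [CompleteSpace H]
    {K : Type*} [NormedAddCommGroup K] [InnerProductSpace ℂ K]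
    (lam : B → WithLp 2 (ℂ × H) →L[ℂ] WithLp 2 (ℂ × H))
    (j : B → K →ₗ[ℂ] K) (k : B → K) (l : B → ℂ)
    (L : H →ₗ[ℂ] K) (Lminus : H →ₗ[ℂ] ℂ) (d : ℝ)
    -- `j` is a unital ⋆-representation of `B` on `K`:
    (hj_one : j 1 = LinearMap.id)
    (hj_mul : ∀ x z : B, j (x * z) = j x ∘ₗ j z)
    (hj_star : ∀ (y : B) (ξ ξ' : K), ⟪j (star y) ξ, ξ'⟫ = ⟪ξ, j y ξ'⟫)
    -- `k` is a `j`-cocycle: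
    (hk : ∀ x z : B, k (x * z) = j x (k z) + k x)
    -- `l` has the coboundary property and is hermitian:
    (hl : ∀ x z : B, l (x * z) = l z + l x + ⟪k (star x), k z⟫)
    (hl_star : ∀ y : B, l (star y) = starRingEnd ℂ (l y))
    -- `lam` is hermitian:
    (hlam_star : ∀ y : B, lam (star y) = ContinuousLinearMap.adjoint (lam y))
    -- the matrix elements of `lam`:
    (h11 : ∀ y : B, ⟪emb 1 (0 : H), lam y (emb 1 0)⟫ = l y + (d : ℂ))
    (h12 : ∀ (y : B) (η : H),
      ⟪emb 1 (0 : H), lam y (emb 0 η)⟫ = ⟪k (star y), L η⟫ + Lminus η)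
    (h22 : ∀ (y : B) (η η' : H),
      ⟪emb 0 η, lam y (emb 0 η')⟫ = ⟪L η, j y (L η')⟫) :
    IsCPDwrt (eProj H) lam := by
  intro N y ζ hζ
  have hz : ∑ i, (ζ i).fst = 0 := by
    have h := congrArg (WithLp.fstL 2 ℂ ℂ H) hζ
    simpa [map_sum, eProj_fst] using h
  have h21 (x : B) (η : H) : ⟪emb 0 η, lam x (emb 1 0)⟫ =
      starRingEnd ℂ (⟪k x, L η⟫ + Lminus η) := by
    rw [← ContinuousLinearMap.adjoint_inner_left, ← hlam_star, ← inner_conj_symm, h12, star_star]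
  have hj (x : B) (ξ ξ' : K) : ⟪ξ, j (star x) ξ'⟫ = ⟪j x ξ, ξ'⟫ := by
    rw [← hj_star, star_star]
  refine sum_sum_nonneg_of_eq_inner_add _
    (fun i => j (y i) (L (ζ i).snd) + (ζ i).fst • k (y i)) (fun i => (ζ i).fst)
    (fun i => (ζ i).fst * (l (y i) + d) + ⟪k (star (y i)), L (ζ i).snd⟫ + Lminus (ζ i).snd)
    (fun i => starRingEnd ℂ ((ζ i).fst) * l (star (y i)) +
      starRingEnd ℂ (⟪k (star (y i)), L (ζ i).snd⟫ + Lminus (ζ i).snd)) hz fun p q => ?_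
  have expand (x : B) (u w : WithLp 2 (ℂ × H)) : ⟪u, lam x w⟫ =
      starRingEnd ℂ u.fst * w.fst * (l x + d) +
      starRingEnd ℂ u.fst * (⟪k (star x), L w.snd⟫ + Lminus w.snd) +
      w.fst * starRingEnd ℂ (⟪k x, L u.snd⟫ + Lminus u.snd) +
      ⟪L u.snd, j x (L w.snd)⟫ := by
    conv_lhs => rw [emb_eq_smul_add u, emb_eq_smul_add w]
    simp only [map_add, map_smul, inner_add_left, inner_add_right, inner_smul_left,
      inner_smul_right, h11, h12, h21, h22]
    ring
  rw [expand]
  simp only [star_mul, star_star, hl, hk, hj_mul, LinearMap.comp_apply, inner_add_left,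
    inner_add_right, inner_smul_left, inner_smul_right, hj_star, hj, map_add, inner_conj_symm]
  ring
end

section
/- Let B be a ⋆-monoid containing an element 0 with 0·y = 0 = y·0 for all y ∈ B and 0⋆ = 0. Let H be a complex Hilbert space, E = ℂ ⊕ H the Hilbert space direct sum, and e ∈ 𝓛(E) the orthogonal projection (ζ,η) ↦ (ζ,0). Let λ : B → 𝓛(E) satisfy λ(y⋆) = λ(y)† for all y and be conditionally positive definite with respect to e. Then the map φ : B → 𝓛(E) defined by φ(y) = λ(y) − λ(0) is positive definite and satisfies φ(0) = 0; consequently λ(y) = φ(y) − κ for all y, with the constant operator κ = −λ(0). -/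
open scoped ComplexOrder

local notation "⟪" x ", " y "⟫" => @inner ℂ _ _ x y

/-- A map `φ : B → 𝓛(E)` is positive definite if all the kernels
`(i, j) ↦ φ(yᵢ⋆ yⱼ)` are positive definite. -/
def IsPDmap {B E : Type*} [Monoid B] [StarMul B]
    [NormedAddCommGroup E] [InnerProductSpace ℂ E]
    (φ : B → E →L[ℂ] E) : Prop :=
  ∀ (N : ℕ) (y : Fin N → B) (ζ : Fin N → E),
    0 ≤ ∑ i, ∑ j, ⟪ζ i, φ (star (y i) * y j) (ζ j)⟫

/-- Subtracting the value at an absorbing self-adjoint element turns a conditionally positive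
definite map into a positive definite one: add the point `z₀` with weight `-∑ i, ζ i`. -/
theorem IsCPDwrt.isPDmap_sub_apply_absorbing {B E : Type*} [Monoid B] [StarMul B]
    [NormedAddCommGroup E] [InnerProductSpace ℂ E] {e : E →L[ℂ] E} {lam : B → E →L[ℂ] E}
    (hcpd : IsCPDwrt e lam) {z₀ : B} (hz₀_left : ∀ y : B, z₀ * y = z₀)
    (hz₀_right : ∀ y : B, y * z₀ = z₀) (hz₀_star : star z₀ = z₀) :
    IsPDmap (fun y => lam y - lam z₀) := by
  intro N y ζ
  have h := hcpd (N + 1) (Fin.cons z₀ y) (Fin.cons (-∑ i, ζ i) ζ)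
    (by simp [Fin.sum_univ_succ])
  simp only [Fin.sum_univ_succ, Fin.cons_zero, Fin.cons_succ, hz₀_star, hz₀_left, hz₀_right,
    Finset.sum_add_distrib, map_neg, inner_neg_left, inner_neg_right,
    Finset.sum_neg_distrib, ← sum_inner] at h
  rw [← inner_sum, ← map_sum, neg_add_cancel, inner_zero_left] at h
  simp only [sub_apply, inner_sub_right, Finset.sum_sub_distrib]
  rw [show ∑ i, ∑ j, ⟪ζ i, lam z₀ (ζ j)⟫ = ⟪∑ i, ζ i, lam z₀ (∑ j, ζ j)⟫ by
    simp only [map_sum, inner_sum, sum_inner]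
    exact Finset.sum_comm]
  convert h using 1
  ring

theorem cpd_splits_as_pd_minus_constant
    {B : Type*} [Monoid B] [StarMul B]
    {H : Type*} [NormedAddCommGroup H] [InnerProductSpace ℂ H] [CompleteSpace H]
    (z₀ : B) (hz₀_left : ∀ y : B, z₀ * y = z₀) (hz₀_right : ∀ y : B, y * z₀ = z₀)
    (hz₀_star : star z₀ = z₀)
    (lam : B → WithLp 2 (ℂ × H) →L[ℂ] WithLp 2 (ℂ × H))
    (hlam_star : ∀ y : B, lam (star y) = ContinuousLinearMap.adjoint (lam y))
    (hcpd : IsCPDwrt (eProj H) lam) :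
    IsPDmap (fun y => lam y - lam z₀) ∧
    (lam z₀ - lam z₀ = 0) ∧
    (∀ y : B, lam y = (fun y => lam y - lam z₀) y - (-(lam z₀))) := by
  exact ⟨hcpd.isPDmap_sub_apply_absorbing hz₀_left hz₀_right hz₀_star, sub_self _,
    fun y => by simp⟩
end

section
/- Let B be a ⋆-monoid and λ : B → ℂ a hermitian function, i.e. λ(y⋆) = conj(λ(y)) for all y ∈ B. Then the following are equivalent: (i) for every real t ≥ 0 the function y ↦ exp(t·λ(y)) is positive definite; (ii) λ is conditionally positive definite. -/
open scoped ComplexOrder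

/-- A function `φ : B → ℂ` on a ⋆-monoid is positive definite if
`∑ᵢⱼ conj ζᵢ * φ(yᵢ⋆ yⱼ) * ζⱼ ≥ 0` for all finite families. -/
def IsPDfun {B : Type*} [Monoid B] [StarMul B] (φ : B → ℂ) : Prop :=
  ∀ (N : ℕ) (y : Fin N → B) (ζ : Fin N → ℂ),
    0 ≤ ∑ i, ∑ j, starRingEnd ℂ (ζ i) * φ (star (y i) * y j) * ζ j

/-- A function `lam : B → ℂ` on a ⋆-monoid is conditionally positive definite if
`∑ᵢⱼ conj ζᵢ * lam(yᵢ⋆ yⱼ) * ζⱼ ≥ 0` whenever `∑ᵢ ζᵢ = 0`. -/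
def IsCPDfun {B : Type*} [Monoid B] [StarMul B] (lam : B → ℂ) : Prop :=
  ∀ (N : ℕ) (y : Fin N → B) (ζ : Fin N → ℂ),
    (∑ i, ζ i) = 0 →
      0 ≤ ∑ i, ∑ j, starRingEnd ℂ (ζ i) * lam (star (y i) * y j) * ζ j

namespace Matrix.PosSemidef

variable {n : Type*} [Finite n] {A : Matrix n n ℂ}

/-- Entrywise powers of a positive semidefinite matrix are positive semidefinite. -/
theorem map_pow (hA : A.PosSemidef) (k : ℕ) : (A.map (· ^ k)).PosSemidef := by
  induction k with
  | zero =>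
    convert posSemidef_vecMulVec_self_star (fun _ : n => (1 : ℂ)) using 1
    ext i j
    simp [vecMulVec_apply]
  | succ k ih =>
    have h : A.map (· ^ (k + 1)) = (A.map (· ^ k)).hadamard A := by
      ext i j
      simp [pow_succ]
    rw [h]
    exact ih.hadamard hA

/-- The entrywise exponential of a positive semidefinite matrix is positive semidefinite. -/
theorem map_exp (hA : A.PosSemidef) : (A.map Complex.exp).PosSemidef := by
  cases nonempty_fintype n
  refine .of_dotProduct_mulVec_nonneg ?_ fun x => ?_
  · ext i j
    simp [← Complex.exp_conj, ← hA.1.apply i j]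
  · have hsum : HasSum
        (fun k : ℕ => ∑ i, ∑ j, star (x i) * (((k.factorial : ℂ)⁻¹ * A i j ^ k) * x j))
        (∑ i, ∑ j, star (x i) * (Complex.exp (A i j) * x j)) := by
      refine hasSum_sum fun i _ => hasSum_sum fun j _ => ?_
      refine HasSum.mul_left _ (HasSum.mul_right _ ?_)
      have h := NormedSpace.exp_series_hasSum_exp' (𝕂 := ℂ) (A i j)
      rw [← Complex.exp_eq_exp_ℂ] at h
      simpa only [smul_eq_mul] using h
    have hk : ∀ k : ℕ,
        0 ≤ ∑ i, ∑ j, star (x i) * (((k.factorial : ℂ)⁻¹ * A i j ^ k) * x j) := by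
      intro k
      have hc : (0 : ℂ) ≤ (k.factorial : ℂ)⁻¹ := by positivity
      have h := mul_nonneg hc ((hA.map_pow k).dotProduct_mulVec_nonneg x)
      refine h.trans_eq ?_
      simp only [dotProduct, mulVec, Finset.mul_sum, Pi.star_apply, map_apply]
      exact Finset.sum_congr rfl fun i _ => Finset.sum_congr rfl fun j _ => by ring
    simpa only [dotProduct, mulVec, Finset.mul_sum, Pi.star_apply, map_apply]
      using hsum.nonneg hk

end Matrix.PosSemidef

section

variable {B : Type*} [Monoid B] [StarMul B] {lam : B → ℂ}

/-- Conditional positive definiteness is the derivative at `0` of the positive definiteness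
of the exponentials. -/
theorem IsCPDfun.of_forall_exp
    (h : ∀ t : ℝ, 0 ≤ t → IsPDfun (fun y => Complex.exp (t * lam y))) : IsCPDfun lam := by
  intro N y ζ hζ
  set F : ℝ → ℂ := fun t =>
    ∑ i, ∑ j, starRingEnd ℂ (ζ i) * Complex.exp (t * lam (star (y i) * y j)) * ζ j with hF
  have hF0 : F 0 = 0 := by
    simp [hF, ← Finset.mul_sum, hζ]
  have hderiv : HasDerivAt F
      (∑ i, ∑ j, starRingEnd ℂ (ζ i) * lam (star (y i) * y j) * ζ j) 0 := by
    refine HasDerivAt.fun_sum fun i _ => HasDerivAt.fun_sum fun j _ => ?_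
    refine HasDerivAt.mul_const (HasDerivAt.const_mul _ ?_) _
    simpa using ((Complex.ofRealCLM.hasDerivAt (x := 0)).mul_const
      (lam (star (y i) * y j))).cexp
  have hlim := hderiv.tendsto_slope.mono_left
    (nhdsWithin_mono (0 : ℝ) (s := Set.Ioi 0) fun t (ht : 0 < t) => ht.ne')
  refine ge_of_tendsto hlim ?_
  filter_upwards [self_mem_nhdsWithin] with t (ht : 0 < t)
  rw [slope_def_module, hF0, sub_zero, sub_zero]
  exact smul_nonneg (inv_nonneg.2 ht.le) (h t ht.le N y ζ)

/-- The kernel of a hermitian conditionally positive definite function, centred at `1`,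
is positive semidefinite. -/
theorem IsCPDfun.posSemidef_centred (h : IsCPDfun lam)
    (hherm : ∀ y : B, lam (star y) = starRingEnd ℂ (lam y)) {N : ℕ} (y : Fin N → B) :
    (Matrix.of fun i j =>
      lam (star (y i) * y j) - lam (star (y i)) - lam (y j) + lam 1).PosSemidef := by
  refine .of_dotProduct_mulVec_nonneg ?_ fun x => ?_
  · ext i j
    simp only [Matrix.conjTranspose_apply, Matrix.of_apply, Complex.star_def, map_add, map_sub,
      ← hherm, star_mul, star_star, star_one]
    ring
  · have h0 := h (N + 1) (Fin.cons 1 y) (Fin.cons (-∑ i, x i) x) (by simp [Fin.sum_univ_succ])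
    refine h0.trans_eq ?_
    simp only [Fin.sum_univ_succ, Fin.cons_zero, Fin.cons_succ, star_one, one_mul, mul_one,
      map_neg, map_sum, dotProduct, Matrix.mulVec, Pi.star_apply, Matrix.of_apply,
      Complex.star_def]
    simp only [mul_add, add_mul, mul_sub, sub_mul, Finset.sum_add_distrib,
      Finset.sum_sub_distrib, Finset.mul_sum, Finset.sum_mul, neg_mul, mul_neg, neg_neg,
      Finset.sum_neg_distrib]
    rw [Finset.sum_comm (f := fun i j => (starRingEnd ℂ) (x j) * lam 1 * x i),
      Finset.sum_comm (f := fun j i => (starRingEnd ℂ) (x i) * lam (y j) * x j)]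
    simp only [mul_assoc]
    ring

/-- The exponentials of a hermitian conditionally positive definite function are positive
definite. -/
theorem IsCPDfun.exp (h : IsCPDfun lam)
    (hherm : ∀ y : B, lam (star y) = starRingEnd ℂ (lam y)) {t : ℝ} (ht : 0 ≤ t) :
    IsPDfun (fun y => Complex.exp (t * lam y)) := by
  intro N y ζ
  have ht' : (0 : ℂ) ≤ t := by exact_mod_cast ht
  have hK := ((h.posSemidef_centred hherm y).smul ht').map_exp
  have h1 : (0 : ℂ) ≤ Complex.exp (-(t * lam 1)) := by
    have him : (lam 1).im = 0 := Complex.conj_eq_iff_im.1 (by rw [← hherm, star_one])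
    have hre : lam 1 = ((lam 1).re : ℂ) := Complex.ext rfl (by simp [him])
    rw [hre, ← Complex.ofReal_mul, ← Complex.ofReal_neg, ← Complex.ofReal_exp]
    exact_mod_cast (Real.exp_pos _).le
  have h2 := mul_nonneg h1
    (hK.dotProduct_mulVec_nonneg fun j => Complex.exp (t * lam (y j)) * ζ j)
  refine h2.trans_eq ?_
  simp only [dotProduct, Matrix.mulVec, Finset.mul_sum, Pi.star_apply, Matrix.map_apply,
    Matrix.smul_apply, Matrix.of_apply, smul_eq_mul, Complex.star_def, map_mul,
    ← Complex.exp_conj, Complex.conj_ofReal, ← hherm]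
  refine Finset.sum_congr rfl fun i _ => Finset.sum_congr rfl fun j _ => ?_
  have hexp : Complex.exp (t * lam (star (y i) * y j)) =
      Complex.exp (-(t * lam 1)) * (Complex.exp (t * lam (star (y i))) *
        (Complex.exp (t * (lam (star (y i) * y j) - lam (star (y i)) - lam (y j) + lam 1)) *
          Complex.exp (t * lam (y j)))) := by
    simp only [← Complex.exp_add]
    congr 1
    ring
  rw [hexp]
  ring

end

/-- Schoenberg-type correspondence: the exponentials `exp (t λ)` are positive
definite for all `t ≥ 0` iff the hermitian function `λ` is conditionally
positive definite. -/
theorem exp_pd_iff_cpd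
    {B : Type*} [Monoid B] [StarMul B]
    (lam : B → ℂ) (hherm : ∀ y : B, lam (star y) = starRingEnd ℂ (lam y)) :
    (∀ t : ℝ, 0 ≤ t → IsPDfun (fun y => Complex.exp (t * lam y))) ↔
      IsCPDfun lam := by
  exact ⟨.of_forall_exp, fun h _ ht => h.exp hherm ht⟩
end
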